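/- arXiv:1902.08719 — 5 statements merged into one kernel-verified Lean document; each statement's English description precedes it below -/
import Mathlib

section
/- Let (R,E) be a ring with enough idempotents that admits a local valuation. Then R is nonsingular (both left and right nonsingular). -/
/-- `I` is a left ideal of the (not necessarily unital) ring `R`, encoded as a set. -/
def IsLeftIdealSet (R : Type) [NonUnitalRing R] (I : Set R) : Prop :=
  0 ∈ I ∧ (∀ x ∈ I, ∀ y ∈ I, x + y ∈ I) ∧ (∀ x ∈ I, -x ∈ I) ∧
    (∀ (a : R), ∀ x ∈ I, a * x ∈ I)

/-- `I` is a right ideal of the (not necessarily unital) ring `R`, encoded as a set. -/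
def IsRightIdealSet (R : Type) [NonUnitalRing R] (I : Set R) : Prop :=
  0 ∈ I ∧ (∀ x ∈ I, ∀ y ∈ I, x + y ∈ I) ∧ (∀ x ∈ I, -x ∈ I) ∧
    (∀ (a : R), ∀ x ∈ I, x * a ∈ I)

/-- `I` is a two-sided ideal of the (not necessarily unital) ring `R`, encoded as a set. -/
def IsTwoSidedIdealSet (R : Type) [NonUnitalRing R] (I : Set R) : Prop :=
  0 ∈ I ∧ (∀ x ∈ I, ∀ y ∈ I, x + y ∈ I) ∧ (∀ x ∈ I, -x ∈ I) ∧
    (∀ (a : R), ∀ x ∈ I, a * x ∈ I) ∧ (∀ (a : R), ∀ x ∈ I, x * a ∈ I)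

/-- A left ideal `I` of `R` is essential if every left ideal `J` with `I ∩ J = {0}`
is the zero ideal. -/
def IsEssentialLeftIdeal (R : Type) [NonUnitalRing R] (I : Set R) : Prop :=
  ∀ J : Set R, IsLeftIdealSet R J → I ∩ J = {0} → J = {0}

/-- A right ideal `I` of `R` is essential if every right ideal `J` with `I ∩ J = {0}`
is the zero ideal. -/
def IsEssentialRightIdeal (R : Type) [NonUnitalRing R] (I : Set R) : Prop :=
  ∀ J : Set R, IsRightIdealSet R J → I ∩ J = {0} → J = {0}

/-- `R` is left nonsingular: the left annihilator of `x` is essential only for `x = 0`. -/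
def LeftNonsingular (R : Type) [NonUnitalRing R] : Prop :=
  ∀ x : R, IsEssentialLeftIdeal R {y : R | y * x = 0} → x = 0

/-- `R` is right nonsingular: the right annihilator of `x` is essential only for `x = 0`. -/
def RightNonsingular (R : Type) [NonUnitalRing R] : Prop :=
  ∀ x : R, IsEssentialRightIdeal R {y : R | x * y = 0} → x = 0

/-- `(R, E)` is a ring with enough idempotents: `E` is a set of nonzero pairwise
orthogonal idempotents of `R` such that the finite sums of distinct elements of `E`
form a set of local units for `R`. -/
structure EnoughIdempotents (R : Type) [NonUnitalRing R] (E : Set R) : Prop where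
  ne_zero : ∀ e ∈ E, e ≠ 0
  idem : ∀ e ∈ E, e * e = e
  orthogonal : ∀ e ∈ E, ∀ f ∈ E, e ≠ f → e * f = 0
  localUnits : ∀ S : Finset R, ∃ F : Finset R, ↑F ⊆ E ∧
    ∀ x ∈ S, (∑ e ∈ F, e) * x * (∑ e ∈ F, e) = x

/-- `(R, E)` is connected: `eRf ≠ {0}` for all `e, f ∈ E`. -/
def ConnectedIdempotents (R : Type) [NonUnitalRing R] (E : Set R) : Prop :=
  ∀ e ∈ E, ∀ f ∈ E, ∃ x : R, e * x * f ≠ 0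

/-- A local valuation on `(R, E)`: a map `ν : R → ℕ₀ ∪ {−∞}` (modelled as `WithBot ℕ`)
such that (i) `ν x = −∞ ↔ x = 0`, (ii) `ν (x - y) ≤ max (ν x) (ν y)` and
(iii) `ν (x * y) = ν x + ν y` whenever `e ∈ E`, `x ∈ Re` and `y ∈ eR`. -/
def IsLocalValuation (R : Type) [NonUnitalRing R] (E : Set R) (ν : R → WithBot ℕ) : Prop :=
  (∀ x : R, ν x = ⊥ ↔ x = 0) ∧
  (∀ x y : R, ν (x - y) ≤ max (ν x) (ν y)) ∧
  (∀ e ∈ E, ∀ x y : R, x * e = x → e * y = y → ν (x * y) = ν x + ν y)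

/-- In a ring with a local valuation, a product `x * y` with `x ∈ Re` and `y ∈ eR` vanishes only
if one of its factors does. -/
theorem IsLocalValuation.eq_zero_or_eq_zero {R : Type} [NonUnitalRing R] {E : Set R}
    {ν : R → WithBot ℕ} (hν : IsLocalValuation R E ν) {e x y : R} (he : e ∈ E)
    (hx : x * e = x) (hy : e * y = y) (hxy : x * y = 0) : x = 0 ∨ y = 0 := by
  have h := hν.2.2 e he x y hx hy
  rw [(hν.1 _).2 hxy, eq_comm, WithBot.add_eq_bot] at h
  exact h.imp (hν.1 x).1 (hν.1 y).1

/-- An element annihilated from the left by every `e ∈ E` is zero. -/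
theorem EnoughIdempotents.eq_zero_of_forall_mul_left {R : Type} [NonUnitalRing R] {E : Set R}
    (hE : EnoughIdempotents R E) {x : R} (h : ∀ e ∈ E, e * x = 0) : x = 0 := by
  obtain ⟨F, hF, hx⟩ := hE.localUnits {x}
  rw [← hx x (Finset.mem_singleton_self x), Finset.sum_mul,
    Finset.sum_eq_zero fun e he => h e (hF he), zero_mul]

/-- An element annihilated from the right by every `e ∈ E` is zero. -/
theorem EnoughIdempotents.eq_zero_of_forall_mul_right {R : Type} [NonUnitalRing R] {E : Set R}
    (hE : EnoughIdempotents R E) {x : R} (h : ∀ e ∈ E, x * e = 0) : x = 0 := by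
  obtain ⟨F, hF, hx⟩ := hE.localUnits {x}
  rw [← hx x (Finset.mem_singleton_self x), mul_assoc, Finset.mul_sum,
    Finset.sum_eq_zero fun e he => h e (hF he), mul_zero]

theorem isLeftIdealSet_setOf_mul_eq_self {R : Type} [NonUnitalRing R] (e : R) :
    IsLeftIdealSet R {y | y * e = y} := by
  refine ⟨zero_mul e, fun x hx y hy => ?_, fun x hx => ?_, fun a x hx => ?_⟩ <;>
    simp_all [add_mul, mul_assoc]

theorem isRightIdealSet_setOf_mul_eq_self {R : Type} [NonUnitalRing R] (e : R) :
    IsRightIdealSet R {y | e * y = y} := by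
  refine ⟨mul_zero e, fun x hx y hy => ?_, fun x hx => ?_, fun a x hx => ?_⟩ <;>
    simp_all [mul_add, ← mul_assoc]

/-- **Proposition 7.6 (Proposition \ref{proplocval1}).** A ring with enough idempotents
that has a local valuation is (left and right) nonsingular. -/
theorem stmt_1 {R : Type} [NonUnitalRing R] (E : Set R)
    (hE : EnoughIdempotents R E) (ν : R → WithBot ℕ)
    (hν : IsLocalValuation R E ν) :
    LeftNonsingular R ∧ RightNonsingular R := by
  constructor
  · intro x hx
    refine hE.eq_zero_of_forall_mul_left fun e he => ?_
    by_contra hex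
    have hJ := hx _ (isLeftIdealSet_setOf_mul_eq_self e) <| by
      refine Set.eq_singleton_iff_unique_mem.2 ⟨⟨zero_mul x, zero_mul e⟩, ?_⟩
      rintro y ⟨hyx : y * x = 0, hye : y * e = y⟩
      refine (hν.eq_zero_or_eq_zero he hye ?_ ?_).resolve_right hex
      · rw [← mul_assoc, hE.idem e he]
      · rw [← mul_assoc, hye, hyx]
    exact hE.ne_zero e he (hJ.subset (hE.idem e he))
  · intro x hx
    refine hE.eq_zero_of_forall_mul_right fun e he => ?_
    by_contra hxe
    have hJ := hx _ (isRightIdealSet_setOf_mul_eq_self e) <| by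
      refine Set.eq_singleton_iff_unique_mem.2 ⟨⟨mul_zero x, mul_zero e⟩, ?_⟩
      rintro y ⟨hxy : x * y = 0, hey : e * y = y⟩
      refine (hν.eq_zero_or_eq_zero he ?_ hey ?_).resolve_left hxe
      · rw [mul_assoc, hE.idem e he]
      · rw [mul_assoc, hey, hxy]
    exact hE.ne_zero e he (hJ.subset (hE.idem e he))
end

section
/- Let (R,E) be a nonzero, connected ring with enough idempotents that admits a local valuation. Then R is a prime ring: for all x,y ∈ R, if xRy = {0} then x = 0 or y = 0. -/
/-- A product of nonzero elements of `Re` and `eR` is nonzero. -/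
theorem IsLocalValuation.mul_ne_zero {R : Type} [NonUnitalRing R] {E : Set R} {ν : R → WithBot ℕ}
    (hν : IsLocalValuation R E ν) {e x y : R} (he : e ∈ E) (hx : x * e = x) (hy : e * y = y)
    (hx0 : x ≠ 0) (hy0 : y ≠ 0) : x * y ≠ 0 := by
  intro h
  have hadd := hν.2.2 e he x y hx hy
  rw [h, (hν.1 0).2 rfl, eq_comm, WithBot.add_eq_bot, hν.1, hν.1] at hadd
  exact hadd.elim hx0 hy0

theorem EnoughIdempotents.exists_mul_ne_zero {R : Type} [NonUnitalRing R] {E : Set R}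
    (hE : EnoughIdempotents R E) {x : R} (hx : x ≠ 0) : ∃ e ∈ E, x * e ≠ 0 := by
  obtain ⟨F, hF, hu⟩ := hE.localUnits {x}
  by_contra! h
  apply hx
  rw [← hu x (Finset.mem_singleton_self x), mul_assoc, Finset.mul_sum,
    Finset.sum_eq_zero fun e he => h e (hF he), mul_zero]

theorem EnoughIdempotents.exists_ne_zero_mul {R : Type} [NonUnitalRing R] {E : Set R}
    (hE : EnoughIdempotents R E) {x : R} (hx : x ≠ 0) : ∃ e ∈ E, e * x ≠ 0 := by
  obtain ⟨F, hF, hu⟩ := hE.localUnits {x}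
  by_contra! h
  apply hx
  rw [← hu x (Finset.mem_singleton_self x), Finset.sum_mul,
    Finset.sum_eq_zero fun e he => h e (hF he), zero_mul]

/-- **Proposition 7.7 (Proposition \ref{proplocval2}).** A nonzero, connected ring with
enough idempotents that has a local valuation is a prime ring. -/
theorem stmt_2 {R : Type} [NonUnitalRing R] [Nontrivial R] (E : Set R)
    (hE : EnoughIdempotents R E) (hconn : ConnectedIdempotents R E)
    (ν : R → WithBot ℕ) (hν : IsLocalValuation R E ν) :
    ∀ x y : R, (∀ z : R, x * z * y = 0) → x = 0 ∨ y = 0 := by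
  intro x y h
  by_contra! hxy
  obtain ⟨e, he, hxe⟩ := hE.exists_mul_ne_zero hxy.1
  obtain ⟨f, hf, hfy⟩ := hE.exists_ne_zero_mul hxy.2
  obtain ⟨w, hw⟩ := hconn e he f hf
  have hee := hE.idem e he
  have hff := hE.idem f hf
  have hleft : x * e * (e * w * f) ≠ 0 :=
    hν.mul_ne_zero he (by rw [mul_assoc, hee]) (by simp only [← mul_assoc, hee]) hxe hw
  refine hν.mul_ne_zero hf (by simp only [mul_assoc, hff]) (by rw [← mul_assoc, hff]) hleft hfy ?_
  simpa only [mul_assoc] using h (e * (e * w * f) * f)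
end

section
/- Let (R,E) be a ring with enough idempotents that admits a nontrivial local valuation. Then R is not von Neumann regular, i.e., there is an x ∈ R such that xyx ≠ x for every y ∈ R. -/
namespace IsLocalValuation

variable {R : Type} [NonUnitalRing R] {E : Set R} {ν : R → WithBot ℕ}

theorem map_zero (hν : IsLocalValuation R E ν) : ν 0 = ⊥ :=
  (hν.1 0).2 rfl

theorem map_add_le (hν : IsLocalValuation R E ν) (x y : R) : ν (x + y) ≤ max (ν x) (ν y) := by
  have hneg : ν (-y) ≤ ν y := by
    simpa [hν.map_zero] using hν.2.1 0 y
  have h := hν.2.1 x (-y)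
  rw [sub_neg_eq_add] at h
  exact h.trans (max_le_max le_rfl hneg)

theorem map_sum_le (hν : IsLocalValuation R E ν) {ι : Type*} (s : Finset ι) (f : ι → R)
    {c : WithBot ℕ} (h : ∀ i ∈ s, ν (f i) ≤ c) : ν (∑ i ∈ s, f i) ≤ c :=
  Finset.sum_induction f (fun x => ν x ≤ c)
    (fun x y hx hy => (hν.map_add_le x y).trans (max_le hx hy))
    (by simp [hν.map_zero]) h

/-- A von Neumann regular element of a corner `eRf` has valuation at most `0`. -/
theorem le_zero_of_mul_mul_self (hν : IsLocalValuation R E ν) {e f x y : R}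
    (he : e ∈ E) (hf : f ∈ E) (hee : e * e = e) (hff : f * f = f)
    (hex : e * x = x) (hxf : x * f = x) (hxyx : x * y * x = x) : ν x ≤ 0 := by
  have hy : x * ((f * y * e) * x) = x := by
    calc x * ((f * y * e) * x) = (x * f) * y * (e * x) := by simp only [mul_assoc]
      _ = x := by rw [hxf, hex, hxyx]
  have h₁ : ν (x * ((f * y * e) * x)) = ν x + ν ((f * y * e) * x) :=
    hν.2.2 f hf _ _ hxf (by simp only [← mul_assoc, hff])
  have h₂ : ν ((f * y * e) * x) = ν (f * y * e) + ν x :=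
    hν.2.2 e he _ _ (by simp only [mul_assoc, hee]) hex
  rw [hy, h₂] at h₁
  generalize ν x = a at h₁ ⊢
  generalize ν (f * y * e) = b at h₁
  induction a with
  | bot => exact bot_le
  | coe a =>
    induction b with
    | bot => simp at h₁
    | coe b =>
      norm_cast at h₁
      obtain rfl : a = 0 := by lia
      exact le_rfl

end IsLocalValuation

/-- **Proposition 7.8 (Proposition \ref{proplocval3}).** A ring with enough idempotents
that has a nontrivial local valuation is not von Neumann regular. -/
theorem stmt_3 {R : Type} [NonUnitalRing R] (E : Set R)
    (hE : EnoughIdempotents R E) (ν : R → WithBot ℕ)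
    (hν : IsLocalValuation R E ν) (hnontriv : ∃ x : R, x ≠ 0 ∧ ν x ≠ 0) :
    ∃ x : R, ∀ y : R, x * y * x ≠ x := by
  by_contra! hreg
  obtain ⟨z, hz, hνz⟩ := hnontriv
  obtain ⟨F, hF, hFz⟩ := hE.localUnits {z}
  have hle : ν z ≤ 0 := by
    rw [← hFz z (Finset.mem_singleton_self z), Finset.mul_sum]
    refine hν.map_sum_le _ _ fun f hf => ?_
    rw [Finset.sum_mul, Finset.sum_mul]
    refine hν.map_sum_le _ _ fun e he => ?_
    obtain ⟨y, hy⟩ := hreg (e * z * f)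
    have hee := hE.idem e (hF he)
    have hff := hE.idem f (hF hf)
    exact hν.le_zero_of_mul_mul_self (hF he) (hF hf) hee hff
      (by simp only [← mul_assoc, hee]) (by simp only [mul_assoc, hff]) hy
  have hbot : ν z ≠ ⊥ := fun h => hz ((hν.1 z).1 h)
  generalize ν z = a at hle hbot hνz
  induction a with
  | bot => exact hbot rfl
  | coe a =>
    have ha : a ≤ 0 := WithBot.coe_le_coe.1 hle
    obtain rfl : a = 0 := by lia
    exact hνz rfl
end

section
/- Let K be a field, (A,E) a K-algebra with enough idempotents, B a K-basis of A consisting of homogeneous elements and containing E, and μ : B → ℕ₀ with μ(b) = 0 iff b ∈ E. If there are elements b, b' ∈ B ∩ eAe for some e ∈ E such that b is adhesive and right cancellative, b' is left adhesive, and b and b' have no common left multiple, then A is not left Noetherian (there is a strictly increasing infinite chain of left ideals of A). -/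
/-- The two-sided ideal of `A` generated by `S`, as a set. -/
def idealClosure (A : Type) [NonUnitalRing A] (S : Set A) : Set A :=
  ⋂₀ {I : Set A | IsTwoSidedIdealSet A I ∧ S ⊆ I}

/-- `b` is a valuative basis element of the `K`-algebra `A` (with respect to the
basis `B`, the set of idempotents `E`, the map `μ`, and `e, f ∈ E`):
`b ∈ B ∩ eAf`, `b` is adhesive, and `μ (a * b * c) = μ a + μ b + μ c`
for all `a ∈ B ∩ Ae` and `c ∈ B ∩ fA`. -/
structure IsValuativeElement {A : Type} [NonUnitalRing A] (E B : Set A) (μ : A → ℕ)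
    (e f b : A) : Prop where
  e_mem : e ∈ E
  f_mem : f ∈ E
  b_mem : b ∈ B
  eb : e * b = b
  bf : b * f = b
  leftAdhesive : ∀ a ∈ B, a * e = a → a * b ∈ B
  rightAdhesive : ∀ c ∈ B, f * c = c → b * c ∈ B
  val : ∀ a ∈ B, a * e = a → ∀ c ∈ B, f * c = c → μ (a * b * c) = μ a + μ b + μ c

/-- The `n`-fold right multiple of an element by `b` in a possibly non-unital ring. -/
def mulRightIter {A : Type} [NonUnitalRing A] (b b' : A) : ℕ → A
  | 0 => b'
  | n + 1 => mulRightIter b b' n * b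

/-- **Proposition 8.7 (Proposition \ref{propvalbas2}), left case.** If there are elements
`b, b' ∈ B ∩ eAe` such that `b` is adhesive and right cancellative, `b'` is left adhesive,
and `b` and `b'` have no common left multiple, then `A` is not left Noetherian. -/
theorem stmt_8 {K A : Type} [Field K] [NonUnitalRing A] [Module K A]
    [IsScalarTower K A A] [SMulCommClass K A A]
    (E : Set A) (hE : EnoughIdempotents A E)
    (B : Set A)
    (hBind : LinearIndependent K (fun x : B => (x : A)))
    (hBspan : Submodule.span K B = ⊤)
    (hBhom : ∀ b ∈ B, ∃ e ∈ E, ∃ f ∈ E, e * b = b ∧ b * f = b)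
    (hEB : E ⊆ B)
    (μ : A → ℕ) (hμ : ∀ b ∈ B, (μ b = 0 ↔ b ∈ E))
    (e b b' : A) (heE : e ∈ E)
    (hbB : b ∈ B) (heb : e * b = b) (hbe : b * e = b)
    (hb'B : b' ∈ B) (heb' : e * b' = b') (hb'e : b' * e = b')
    -- `b` is adhesive:
    (hbladh : ∀ a ∈ B, a * e = a → a * b ∈ B)
    (hbradh : ∀ c ∈ B, e * c = c → b * c ∈ B)
    -- `b` is right cancellative:
    (hbrc : ∀ a ∈ B, a * e = a → ∀ c ∈ B, c * e = c → a * b = c * b → a = c)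
    -- `b'` is left adhesive:
    (hb'ladh : ∀ a ∈ B, a * e = a → a * b' ∈ B)
    -- `b` and `b'` have no common left multiple:
    (hnclm : ¬ ∃ a ∈ B, ∃ a' ∈ B, a * e = a ∧ a' * e = a' ∧ a * b = a' * b') :
    ∃ C : ℕ → Set A, (∀ n, IsLeftIdealSet A (C n)) ∧ ∀ n, C n ⊂ C (n + 1) := by
  let g : ℕ → A := mulRightIter b b'
  have hg0 : g 0 = b' := rfl
  have hgs : ∀ n, g (n + 1) = g n * b := fun _ => rfl
  have heg : ∀ n, e * g n = g n := by
    intro n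
    induction n with
    | zero => exact heb'
    | succ n ih => rw [hgs, ← mul_assoc, ih]
  have hge : ∀ n, g n * e = g n := by
    intro n
    cases n with
    | zero => exact hb'e
    | succ n => rw [hgs, mul_assoc, hbe]
  have hagB : ∀ n, ∀ a ∈ B, a * e = a → a * g n ∈ B := by
    intro n a ha hae
    induction n with
    | zero => exact hb'ladh a ha hae
    | succ n ih =>
      rw [hgs, ← mul_assoc]
      exact hbladh _ ih (by rw [mul_assoc, hge])
  have heB : e ∈ B := hEB heE
  have hee : e * e = e := hE.idem e heE
  have hgB : ∀ n, g n ∈ B := fun n => heg n ▸ hagB n e heB hee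
  have hne : ∀ i n, ∀ a ∈ B, a * e = a → g (n + 1 + i) ≠ a * g i := by
    intro i n a ha hae
    induction i with
    | zero =>
      intro h
      exact hnclm ⟨g n, hgB n, a, ha, hge n, hae, h⟩
    | succ i ih =>
      intro h
      refine ih (hbrc _ (hgB _) (hge _) _ (hagB i a ha hae) (by rw [mul_assoc, hge]) ?_)
      rw [mul_assoc, ← hgs i]
      exact h
  let S : ℕ → Set A := fun n => {y | ∃ i < n, ∃ a ∈ B, a * e = a ∧ y = a * g i}
  have hSB : ∀ n, S n ⊆ B := by
    rintro n y ⟨i, -, a, ha, hae, rfl⟩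
    exact hagB i a ha hae
  have hmul : ∀ n, ∀ i < n, ∀ x : A, x * g i ∈ Submodule.span K (S n) := by
    intro n i hi x
    have hx : x ∈ Submodule.span K B := hBspan ▸ Submodule.mem_top
    induction hx using Submodule.span_induction with
    | mem c hc =>
      obtain ⟨-, -, f, hf, -, hcf⟩ := hBhom c hc
      by_cases hfe : f = e
      · subst hfe
        exact Submodule.subset_span ⟨i, hi, c, hc, hcf, rfl⟩
      · have : c * g i = 0 := by
          rw [← heg i, ← hcf, mul_assoc, ← mul_assoc f, hE.orthogonal f hf e heE hfe, zero_mul,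
            mul_zero]
        rw [this]
        exact Submodule.zero_mem _
    | zero => rw [zero_mul]; exact Submodule.zero_mem _
    | add x y _ _ hx hy => rw [add_mul]; exact Submodule.add_mem _ hx hy
    | smul k x _ hx => rw [smul_mul_assoc]; exact Submodule.smul_mem _ k hx
  refine ⟨fun n => Submodule.span K (S n), fun n => ⟨Submodule.zero_mem _,
    fun x hx y hy => Submodule.add_mem _ hx hy, fun x hx => Submodule.neg_mem _ hx, ?_⟩, fun n => ?_⟩
  · intro a x hx
    change a * x ∈ Submodule.span K (S n)
    induction hx using Submodule.span_induction with
    | mem y hy =>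
      obtain ⟨i, hi, c, -, -, rfl⟩ := hy
      rw [← mul_assoc]
      exact hmul n i hi _
    | zero => rw [mul_zero]; exact Submodule.zero_mem _
    | add x y _ _ hx hy => rw [mul_add]; exact Submodule.add_mem _ hx hy
    | smul k x _ hx => rw [mul_smul_comm]; exact Submodule.smul_mem _ k hx
  · refine (Set.ssubset_iff_of_subset (Submodule.span_mono ?_)).2 ⟨g n, ?_, ?_⟩
    · rintro y ⟨i, hi, h⟩
      exact ⟨i, hi.trans n.lt_succ_self, h⟩
    · exact Submodule.subset_span ⟨n, n.lt_succ_self, e, heB, hee, (heg n).symm⟩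
    · have hnot : (⟨g n, hgB n⟩ : B) ∉ (Subtype.val ⁻¹' S n : Set B) := by
        rintro ⟨i, hi, a, ha, hae, h⟩
        obtain ⟨k, rfl⟩ := Nat.exists_eq_add_of_lt hi
        refine hne i k a ha hae ?_
        rw [← h]
        congr 1
        omega
      have := hBind.notMem_span_image hnot
      rwa [Subtype.image_preimage_coe, Set.inter_eq_right.2 (hSB n)] at this
end

section
/- Let H be a hypergraph and K a field. Then there is a grading of L_K(H) by the free abelian group on the index set {1,…,n} (equivalently, finitely supported functions to ℤ), where n = sup{|s(h)| : h ∈ H^1} (possibly infinite), such that deg(v) = 0 for every v ∈ H^0, deg(h_{ij}) = α_i and deg(h_{ij}^*) = −α_i for every h ∈ H^1, 1 ≤ i ≤ |s(h)|, 1 ≤ j ≤ |r(h)|, where α_i is the generator with 1 in the i-th component and 0 elsewhere. That is, L_K(H) decomposes as a direct sum of K-subspaces indexed by the group, multiplication adds degrees, and the generators are homogeneous of the stated degrees. -/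
open scoped Classical

/-- The generators of the Leavitt path algebra of a hypergraph `H = (H0, H1, s, r)`:
a vertex generator `v` for every `v ∈ H0`, and generators `h_{ij}` (`edge`) and
`h_{ij}^*` (`ghost`) for every hyperedge `h ∈ H1`, `1 ≤ i ≤ |s(h)|`, `1 ≤ j ≤ |r(h)|`.
The multisets `s(h)` and `r(h)` are given as (enumerated) lists over `H0`. -/
inductive HGen (H0 H1 : Type) (s r : H1 → List H0) : Type
  | vertex (v : H0) : HGen H0 H1 s r
  | edge (h : H1) (i : Fin (s h).length) (j : Fin (r h).length) : HGen H0 H1 s r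
  | ghost (h : H1) (i : Fin (s h).length) (j : Fin (r h).length) : HGen H0 H1 s r

namespace HLPA

variable (K : Type) [Field K] (H0 H1 : Type) (s r : H1 → List H0)

/-- The defining relations (i)-(iv) of the Leavitt path algebra of a hypergraph,
imposed on the free algebra on the generators. -/
inductive Rel : FreeAlgebra K (HGen H0 H1 s r) → FreeAlgebra K (HGen H0 H1 s r) → Prop
  | vtx (u v : H0) :
      Rel (FreeAlgebra.ι K (HGen.vertex u : HGen H0 H1 s r) * FreeAlgebra.ι K (HGen.vertex v))
        (if u = v then FreeAlgebra.ι K (HGen.vertex u : HGen H0 H1 s r) else 0)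
  | src_edge (h : H1) (i : Fin (s h).length) (j : Fin (r h).length) :
      Rel (FreeAlgebra.ι K (HGen.vertex ((s h).get i) : HGen H0 H1 s r) *
            FreeAlgebra.ι K (HGen.edge h i j))
        (FreeAlgebra.ι K (HGen.edge h i j))
  | edge_rng (h : H1) (i : Fin (s h).length) (j : Fin (r h).length) :
      Rel (FreeAlgebra.ι K (HGen.edge h i j : HGen H0 H1 s r) *
            FreeAlgebra.ι K (HGen.vertex ((r h).get j)))
        (FreeAlgebra.ι K (HGen.edge h i j))
  | rng_ghost (h : H1) (i : Fin (s h).length) (j : Fin (r h).length) :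
      Rel (FreeAlgebra.ι K (HGen.vertex ((r h).get j) : HGen H0 H1 s r) *
            FreeAlgebra.ι K (HGen.ghost h i j))
        (FreeAlgebra.ι K (HGen.ghost h i j))
  | ghost_src (h : H1) (i : Fin (s h).length) (j : Fin (r h).length) :
      Rel (FreeAlgebra.ι K (HGen.ghost h i j : HGen H0 H1 s r) *
            FreeAlgebra.ι K (HGen.vertex ((s h).get i)))
        (FreeAlgebra.ι K (HGen.ghost h i j))
  | cuntz1 (h : H1) (i i' : Fin (s h).length) :
      Rel (∑ k : Fin (r h).length,
            FreeAlgebra.ι K (HGen.edge h i k : HGen H0 H1 s r) *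
              FreeAlgebra.ι K (HGen.ghost h i' k))
        (if i = i' then FreeAlgebra.ι K (HGen.vertex ((s h).get i) : HGen H0 H1 s r) else 0)
  | cuntz2 (h : H1) (j j' : Fin (r h).length) :
      Rel (∑ k : Fin (s h).length,
            FreeAlgebra.ι K (HGen.ghost h k j : HGen H0 H1 s r) *
              FreeAlgebra.ι K (HGen.edge h k j'))
        (if j = j' then FreeAlgebra.ι K (HGen.vertex ((r h).get j) : HGen H0 H1 s r) else 0)

/-- The universal unital algebra on the generators subject to the relations (i)-(iv);
it is the unitalization of the Leavitt path algebra of the hypergraph. -/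
abbrev Ambient : Type := RingQuot (Rel K H0 H1 s r)

/-- The image of a generator in the ambient algebra. -/
noncomputable def amb (g : HGen H0 H1 s r) : Ambient K H0 H1 s r :=
  RingQuot.mkAlgHom K (Rel K H0 H1 s r) (FreeAlgebra.ι K g)

/-- The Leavitt path algebra of the hypergraph `(H0, H1, s, r)`, realized as the
non-unital subalgebra generated by the generators inside the universal unital algebra
on the generators subject to the relations (i)-(iv). (This is the algebra presented,
in the category of not necessarily unital `K`-algebras, by said generators and
relations.) -/
noncomputable def LPAsub : NonUnitalSubalgebra K (Ambient K H0 H1 s r) :=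
  NonUnitalAlgebra.adjoin K (Set.range (amb K H0 H1 s r))

/-- The Leavitt path algebra `L_K(H)` of the hypergraph `H = (H0, H1, s, r)`. -/
abbrev LPA : Type := ↥(LPAsub K H0 H1 s r)

variable {H0 H1 s r}

/-- A generator, as an element of the Leavitt path algebra. -/
noncomputable def genL (g : HGen H0 H1 s r) : LPA K H0 H1 s r :=
  ⟨amb K H0 H1 s r g, NonUnitalAlgebra.subset_adjoin K (Set.mem_range_self g)⟩

/-- The vertex generator `v ∈ H0` as an element of the Leavitt path algebra. -/
noncomputable def vgen (v : H0) : LPA K H0 H1 s r := genL K (HGen.vertex v)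

/-- The generator `h_{ij}` as an element of the Leavitt path algebra. -/
noncomputable def egen (h : H1) (i : Fin (s h).length) (j : Fin (r h).length) :
    LPA K H0 H1 s r := genL K (HGen.edge h i j)

/-- The generator `h_{ij}^*` as an element of the Leavitt path algebra. -/
noncomputable def ggen (h : H1) (i : Fin (s h).length) (j : Fin (r h).length) :
    LPA K H0 H1 s r := genL K (HGen.ghost h i j)

end HLPA

namespace HLPA

variable (K : Type) [Field K] (H0 H1 : Type) (s r : H1 → List H0)

noncomputable instance instLPANonUnitalRing : NonUnitalRing (LPA K H0 H1 s r) :=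
  NonUnitalSubalgebra.toNonUnitalRing (LPAsub K H0 H1 s r)

noncomputable instance instLPAAddCommGroup : AddCommGroup (LPA K H0 H1 s r) :=
  (instLPANonUnitalRing K H0 H1 s r).toAddCommGroup

noncomputable instance instLPAModule : Module K (LPA K H0 H1 s r) :=
  (LPAsub K H0 H1 s r).instModule

end HLPA

theorem AddMonoidAlgebra.finsetSum_single {R G ι : Type*} [Semiring R] (t : Finset ι) (g : G)
    (f : ι → R) : ∑ k ∈ t, AddMonoidAlgebra.single g (f k) =
      AddMonoidAlgebra.single g (∑ k ∈ t, f k) :=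
  (map_sum (⟨⟨AddMonoidAlgebra.single g, AddMonoidAlgebra.single_zero g⟩,
    AddMonoidAlgebra.single_add g⟩ : R →+ AddMonoidAlgebra R G) f t).symm

namespace HLPA

/-- The degree of a generator in the free abelian group on the positions in sources. -/
noncomputable def genDegree {H0 H1 : Type} {s r : H1 → List H0} :
    HGen H0 H1 s r → ({i : ℕ // ∃ h : H1, i < (s h).length} →₀ ℤ)
  | .vertex _ => 0
  | .edge h i _ => Finsupp.single ⟨(i : ℕ), h, i.isLt⟩ 1
  | .ghost h i _ => -Finsupp.single ⟨(i : ℕ), h, i.isLt⟩ 1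

variable (K : Type) [Field K] (H0 H1 : Type) (s r : H1 → List H0)

/-- The coaction of the grading group, on the free algebra. -/
noncomputable def freeCoaction : FreeAlgebra K (HGen H0 H1 s r) →ₐ[K]
    AddMonoidAlgebra (Ambient K H0 H1 s r) ({i : ℕ // ∃ h : H1, i < (s h).length} →₀ ℤ) :=
  FreeAlgebra.lift K fun g => AddMonoidAlgebra.single (genDegree g) (amb K H0 H1 s r g)

theorem freeCoaction_ι (g : HGen H0 H1 s r) :
    freeCoaction K H0 H1 s r (FreeAlgebra.ι K g) =
      AddMonoidAlgebra.single (genDegree g) (amb K H0 H1 s r g) :=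
  FreeAlgebra.lift_ι_apply _ _

theorem freeCoaction_rel {a b : FreeAlgebra K (HGen H0 H1 s r)} (hab : Rel K H0 H1 s r a b) :
    freeCoaction K H0 H1 s r a = freeCoaction K H0 H1 s r b := by
  have key := RingQuot.mkAlgHom_rel K hab
  cases hab with
  | vtx u v =>
    split_ifs at key ⊢ with h <;>
      simp only [map_mul, map_zero, freeCoaction_ι, AddMonoidAlgebra.single_mul_single] at key ⊢ <;>
      simp only [amb, genDegree, key, add_zero, AddMonoidAlgebra.single_zero]
  | src_edge h i j =>
    simp only [map_mul, freeCoaction_ι, AddMonoidAlgebra.single_mul_single] at key ⊢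
    simp only [amb, genDegree, key, zero_add]
  | edge_rng h i j =>
    simp only [map_mul, freeCoaction_ι, AddMonoidAlgebra.single_mul_single] at key ⊢
    simp only [amb, genDegree, key, add_zero]
  | rng_ghost h i j =>
    simp only [map_mul, freeCoaction_ι, AddMonoidAlgebra.single_mul_single] at key ⊢
    simp only [amb, genDegree, key, zero_add]
  | ghost_src h i j =>
    simp only [map_mul, freeCoaction_ι, AddMonoidAlgebra.single_mul_single] at key ⊢
    simp only [amb, genDegree, key, add_zero]
  | cuntz1 h i i' =>
    simp only [map_sum, map_mul, freeCoaction_ι, AddMonoidAlgebra.single_mul_single] at key ⊢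
    simp only [amb, genDegree, AddMonoidAlgebra.finsetSum_single, key]
    split_ifs with hi
    · simp only [freeCoaction_ι, hi, amb, genDegree, add_neg_cancel]
    · simp only [map_zero, AddMonoidAlgebra.single_zero]
  | cuntz2 h j j' =>
    simp only [map_sum, map_mul, freeCoaction_ι, AddMonoidAlgebra.single_mul_single] at key ⊢
    simp only [amb, genDegree, neg_add_cancel, AddMonoidAlgebra.finsetSum_single, key]
    split_ifs with hj
    · simp only [freeCoaction_ι, amb, genDegree]
    · simp only [map_zero, AddMonoidAlgebra.single_zero]

/-- The coaction of the grading group on the ambient unital algebra. -/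
noncomputable def coaction : Ambient K H0 H1 s r →ₐ[K]
    AddMonoidAlgebra (Ambient K H0 H1 s r) ({i : ℕ // ∃ h : H1, i < (s h).length} →₀ ℤ) :=
  RingQuot.liftAlgHom K ⟨freeCoaction K H0 H1 s r, fun _ _ => freeCoaction_rel K H0 H1 s r⟩

theorem coaction_amb (g : HGen H0 H1 s r) :
    coaction K H0 H1 s r (amb K H0 H1 s r g) =
      AddMonoidAlgebra.single (genDegree g) (amb K H0 H1 s r g) := by
  rw [coaction, amb, RingQuot.liftAlgHom_mkAlgHom_apply, freeCoaction_ι, amb]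

/-- The elements of the Leavitt path algebra that are homogeneous of degree `γ`. -/
noncomputable def homogeneousPart (γ : {i : ℕ // ∃ h : H1, i < (s h).length} →₀ ℤ) :
    Submodule K (LPA K H0 H1 s r) where
  carrier := {x | coaction K H0 H1 s r x.1 = AddMonoidAlgebra.single γ x.1}
  zero_mem' := by
    change coaction K H0 H1 s r 0 = AddMonoidAlgebra.single γ 0
    rw [map_zero, AddMonoidAlgebra.single_zero]
  add_mem' {x y} hx hy := by
    change coaction K H0 H1 s r (x.1 + y.1) = AddMonoidAlgebra.single γ (x.1 + y.1)
    rw [map_add, hx, hy, AddMonoidAlgebra.single_add]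
  smul_mem' c x hx := by
    change coaction K H0 H1 s r (c • x.1) = AddMonoidAlgebra.single γ (c • x.1)
    rw [map_smul, hx, AddMonoidAlgebra.smul_single]

variable {K H0 H1 s r}

theorem mem_homogeneousPart {γ : {i : ℕ // ∃ h : H1, i < (s h).length} →₀ ℤ}
    {x : LPA K H0 H1 s r} : x ∈ homogeneousPart K H0 H1 s r γ ↔
      coaction K H0 H1 s r x.1 = AddMonoidAlgebra.single γ x.1 :=
  Iff.rfl

theorem genL_mem_homogeneousPart (g : HGen H0 H1 s r) :
    genL K g ∈ homogeneousPart K H0 H1 s r (genDegree g) :=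
  coaction_amb K H0 H1 s r g

theorem mul_mem_homogeneousPart {γ δ : {i : ℕ // ∃ h : H1, i < (s h).length} →₀ ℤ}
    {x y : LPA K H0 H1 s r} (hx : x ∈ homogeneousPart K H0 H1 s r γ)
    (hy : y ∈ homogeneousPart K H0 H1 s r δ) :
    x * y ∈ homogeneousPart K H0 H1 s r (γ + δ) := by
  change coaction K H0 H1 s r (x.1 * y.1) = AddMonoidAlgebra.single (γ + δ) (x.1 * y.1)
  rw [map_mul, mem_homogeneousPart.1 hx, mem_homogeneousPart.1 hy,
    AddMonoidAlgebra.single_mul_single]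

theorem mul_mem_iSup_homogeneousPart {x y : LPA K H0 H1 s r}
    (hx : x ∈ iSup (homogeneousPart K H0 H1 s r)) (hy : y ∈ iSup (homogeneousPart K H0 H1 s r)) :
    x * y ∈ iSup (homogeneousPart K H0 H1 s r) := by
  induction hx using Submodule.iSup_induction' with
  | mem γ x hx =>
    induction hy using Submodule.iSup_induction' with
    | mem δ y hy => exact Submodule.mem_iSup_of_mem _ (mul_mem_homogeneousPart hx hy)
    | zero => rw [mul_zero]; exact zero_mem _
    | add y z _ _ hy hz => rw [mul_add]; exact add_mem hy hz
  | zero => rw [zero_mul]; exact zero_mem _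
  | add x z _ _ hx hz => rw [add_mul]; exact add_mem hx hz

theorem iSup_homogeneousPart : iSup (homogeneousPart K H0 H1 s r) = ⊤ := by
  rw [eq_top_iff]
  rintro ⟨x, hx⟩ -
  induction hx using NonUnitalAlgebra.adjoin_induction with
  | mem x hx =>
    obtain ⟨g, rfl⟩ := hx
    exact Submodule.mem_iSup_of_mem _ (genL_mem_homogeneousPart g)
  | zero => exact zero_mem (iSup (homogeneousPart K H0 H1 s r))
  | add x y _ _ hx hy => exact add_mem hx hy
  | mul x y _ _ hx hy => exact mul_mem_iSup_homogeneousPart hx hy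
  | smul c x _ hx => exact Submodule.smul_mem _ c hx

theorem iSupIndep_homogeneousPart : iSupIndep (homogeneousPart K H0 H1 s r) := by
  intro γ
  rw [Submodule.disjoint_def]
  intro x hx hx'
  have vanish : (coaction K H0 H1 s r x.1).coeff γ = 0 := by
    clear hx
    induction hx' using Submodule.iSup_induction' with
    | mem δ x hx =>
      by_cases hδ : δ = γ
      · subst hδ
        simp only [ne_eq, not_true_eq_false, iSup_false, Submodule.mem_bot] at hx
        subst hx
        change (coaction K H0 H1 s r 0).coeff δ = 0
        rw [map_zero]; rfl
      · rw [iSup_pos hδ] at hx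
        rw [mem_homogeneousPart.1 hx, AddMonoidAlgebra.coeff_single, Finsupp.single_eq_of_ne' hδ]
    | zero =>
      change (coaction K H0 H1 s r 0).coeff γ = 0
      rw [map_zero]; rfl
    | add x y _ _ hx hy =>
      change (coaction K H0 H1 s r (x.1 + y.1)).coeff γ = 0
      rw [map_add, AddMonoidAlgebra.coeff_add, Finsupp.add_apply, hx, hy, add_zero]
  rw [mem_homogeneousPart.1 hx, AddMonoidAlgebra.coeff_single, Finsupp.single_eq_same] at vanish
  exact Subtype.ext vanish

end HLPA

open HLPA in
/-- **Proposition 3.6 (iii) (Proposition \ref{propprop} (iii)).** The Leavitt path algebra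
`L_K(H)` carries a grading by the free abelian group `ℤ^(n)` on the index set
`{1, …, n}`, `n = sup{|s(h)| : h ∈ H^1}` (realized as finitely supported functions
`{i : ℕ // ∃ h, i < |s(h)|} →₀ ℤ`), in which `deg v = 0`, `deg h_{ij} = α_i` and
`deg h_{ij}^* = -α_i`: the algebra is the internal direct sum of the homogeneous
components, multiplication adds degrees, and the generators are homogeneous of the
stated degrees. -/
theorem stmt_10 (K : Type) [Field K] (H0 H1 : Type) [Nonempty H0]
    (s r : H1 → List H0) (hs : ∀ h, s h ≠ []) (hr : ∀ h, r h ≠ []) :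
    ∃ 𝒜 : ({i : ℕ // ∃ h : H1, i < (s h).length} →₀ ℤ) →
        Submodule K (LPA K H0 H1 s r),
      iSupIndep 𝒜 ∧
      iSup 𝒜 = ⊤ ∧
      (∀ γ δ, ∀ x ∈ 𝒜 γ, ∀ y ∈ 𝒜 δ, x * y ∈ 𝒜 (γ + δ)) ∧
      (∀ v : H0, vgen K v ∈ 𝒜 0) ∧
      (∀ (h : H1) (i : Fin (s h).length) (j : Fin (r h).length),
        egen K h i j ∈ 𝒜 (Finsupp.single ⟨(i : ℕ), h, i.isLt⟩ 1)) ∧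
      (∀ (h : H1) (i : Fin (s h).length) (j : Fin (r h).length),
        ggen K h i j ∈ 𝒜 (-(Finsupp.single ⟨(i : ℕ), h, i.isLt⟩ 1))) := by
  exact ⟨homogeneousPart K H0 H1 s r, iSupIndep_homogeneousPart, iSup_homogeneousPart,
    fun _ _ _ hx _ hy => mul_mem_homogeneousPart hx hy,
    fun v => genL_mem_homogeneousPart (.vertex v),
    fun h i j => genL_mem_homogeneousPart (.edge h i j),
    fun h i j => genL_mem_homogeneousPart (.ghost h i j)⟩
end
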